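/- Let B ⊂ ℝ² be a convex polygon with vertices in ℤ². Then area(B) ≥ (3/8) ω(B)², where ω(B) is the minimal lattice width of B. -/

import Mathlib

open Finset Set MeasureTheory

/-- Embedding of lattice points into the real plane. -/
def toR (p : ℤ × ℤ) : ℝ × ℝ := ((p.1 : ℝ), (p.2 : ℝ))

/-- Integer pairing `u ⋅ p`. -/
def zdot (u p : ℤ × ℤ) : ℤ := u.1 * p.1 + u.2 * p.2

/-- The lattice width of the lattice polygon with vertex set `S` in the direction `u`. -/
def widthZ (u : ℤ × ℤ) (S : Finset (ℤ × ℤ)) (h : S.Nonempty) : ℤ :=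
  S.sup' h (zdot u) - S.inf' h (zdot u)

/-- The Euclidean area of the convex hull of the lattice points `S`. -/
noncomputable def areaOf (S : Finset (ℤ × ℤ)) : ℝ :=
  (volume (convexHull ℝ (toR '' (S : Set (ℤ × ℤ))))).toReal

theorem real_ineq (w w2 b c p q : ℝ) (hw : 0 < w) (hw2 : w ≤ w2) (hb : 0 < b) (hc : 0 < c)
    (hp : 0 ≤ p) (hq : 0 ≤ q) (hpq : w ≤ p + q)
    (h1 : w * w2 - b * c < 3 / 4 * w ^ 2) (h2 : w * q + b * p < 3 / 4 * w ^ 2)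
    (h3 : c * q + w2 * p < 3 / 4 * w ^ 2) : False := by
  have hs : 0 < p + q := by linarith
  -- rescale `(p, q)` to sum `w`
  obtain ⟨r, hr0, hrp, hrq⟩ : ∃ r, 0 ≤ r ∧ r ≤ p ∧ w - r ≤ q ∧ r ≤ w := by
    by_cases hpw : p ≤ w
    · exact ⟨p, hp, le_refl _, by linarith, hpw⟩
    · exact ⟨w, hw.le, by linarith, by linarith, le_refl _⟩
  obtain ⟨hrq, hrw⟩ := hrq
  have hww : w * w ≤ w * w2 := mul_le_mul_of_nonneg_left hw2 hw.le
  have g1 : w ^ 2 / 4 < b * c := by nlinarith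
  have g2 : w ^ 2 / 4 < r * (w - b) := by
    have := mul_le_mul_of_nonneg_left hrq hw.le
    have := mul_le_mul_of_nonneg_left hrp hb.le
    nlinarith
  have g3 : w ^ 2 / 4 < (w - r) * (w - c) := by
    have := mul_le_mul_of_nonneg_left hrq hc.le
    have := mul_le_mul hw2 hrp hr0 (by linarith)
    nlinarith
  have hw4 : 0 < w ^ 2 / 4 := by positivity
  have e1 : b * (w - b) ≤ w ^ 2 / 4 := by nlinarith [sq_nonneg (w - 2 * b)]
  have e2 : c * (w - c) ≤ w ^ 2 / 4 := by nlinarith [sq_nonneg (w - 2 * c)]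
  have e3 : r * (w - r) ≤ w ^ 2 / 4 := by nlinarith [sq_nonneg (w - 2 * r)]
  have hwb : 0 < w - b := by
    by_contra hh
    nlinarith
  have hwc : 0 < w - c := by
    by_contra hh
    nlinarith
  have k1 : (w ^ 2 / 4) * (w ^ 2 / 4) < (b * c) * (r * (w - b)) :=
    mul_lt_mul'' g1 g2 hw4.le hw4.le
  have k2 := mul_lt_mul'' k1 g3 (by positivity) hw4.le
  have k3 : (b * (w - b)) * (c * (w - c)) ≤ (w ^ 2 / 4) * (w ^ 2 / 4) :=
    mul_le_mul e1 e2 (by positivity) hw4.le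
  have k4 := mul_le_mul k3 e3 (mul_nonneg hr0 (by linarith)) (by positivity)
  nlinarith

/-- Standard triangle with one side removed. -/
def stdTri : Set (ℝ × ℝ) := regionBetween (fun _ => (0:ℝ)) (fun x => 1 - x) (Icc 0 1)

theorem vol_stdTri : volume stdTri = ENNReal.ofReal (1 / 2) := by
  unfold stdTri
  rw [Measure.volume_eq_prod, volume_regionBetween_eq_integral]
  · congr 1
    rw [integral_Icc_eq_integral_Ioc, ← intervalIntegral.integral_of_le zero_le_one]
    simp only [Pi.sub_apply, sub_zero]
    rw [intervalIntegral.integral_sub (by simp) (by simp)]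
    simp
    norm_num
  · exact continuousOn_const.integrableOn_Icc
  · exact Continuous.integrableOn_Icc (by fun_prop)
  · exact measurableSet_Icc
  · intro x hx
    simpa using hx.2

def cr (v w : ℝ × ℝ) : ℝ := v.1 * w.2 - v.2 * w.1

noncomputable def triMap (v w : ℝ × ℝ) : (ℝ × ℝ) →ₗ[ℝ] (ℝ × ℝ) :=
  Matrix.toLin (Module.Basis.finTwoProd ℝ) (Module.Basis.finTwoProd ℝ) !![v.1, w.1; v.2, w.2]

theorem triMap_apply (v w x : ℝ × ℝ) : triMap v w x = x.1 • v + x.2 • w := by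
  unfold triMap
  rw [Matrix.toLin_finTwoProd_apply]
  ext <;> simp <;> ring

theorem triMap_det (v w : ℝ × ℝ) : LinearMap.det (triMap v w) = cr v w := by
  unfold triMap cr
  rw [LinearMap.det_toLin, Matrix.det_fin_two_of]
  ring

def tri (A B C : ℝ × ℝ) : Set (ℝ × ℝ) := (fun x => A + x) '' (triMap (B - A) (C - A) '' stdTri)

theorem vol_tri (A B C : ℝ × ℝ) :
    volume (tri A B C) = ENNReal.ofReal (|cr (B - A) (C - A)| / 2) := by
  unfold tri
  rw [Set.image_add_left, measure_preimage_add, Measure.addHaar_image_linearMap, triMap_det,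
    vol_stdTri, ← ENNReal.ofReal_mul (abs_nonneg _)]
  congr 1
  ring

theorem mem_tri {A B C X : ℝ × ℝ} (h : X ∈ tri A B C) :
    ∃ s t : ℝ, 0 ≤ s ∧ 0 < t ∧ s + t ≤ 1 ∧ X = A + (s • (B - A) + t • (C - A)) := by
  obtain ⟨_, ⟨x, hx, rfl⟩, rfl⟩ := h
  obtain ⟨h1, h2⟩ := hx
  refine ⟨x.1, x.2, h1.1, h2.1, ?_, ?_⟩
  · have := h2.2
    simp only at this
    linarith
  · simp only [triMap_apply]

theorem tri_subset {K : Set (ℝ × ℝ)} (hK : Convex ℝ K) {A B C : ℝ × ℝ} (hA : A ∈ K) (hB : B ∈ K)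
    (hC : C ∈ K) : tri A B C ⊆ K := by
  intro X hX
  obtain ⟨s, t, hs, ht, hst, rfl⟩ := mem_tri hX
  have := hK.sum_mem (t := (Finset.univ : Finset (Fin 3))) (w := ![1 - s - t, s, t])
    (z := ![A, B, C]) (by
      intro i _
      fin_cases i <;> simp <;> linarith) (by simp [Fin.sum_univ_three]; ring) (by
      intro i _
      fin_cases i <;> simp [hA, hB, hC])
  rw [Fin.sum_univ_three] at this
  convert this using 1
  ext <;> simp <;> ring

theorem cr_tri {A B C X : ℝ × ℝ} (h : X ∈ tri A B C) :
    ∃ t : ℝ, 0 < t ∧ cr (B - A) (X - A) = t * cr (B - A) (C - A) := by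
  obtain ⟨s, t, hs, ht, hst, rfl⟩ := mem_tri h
  refine ⟨t, ht, ?_⟩
  simp [cr]
  ring

theorem area_opp {K : Set (ℝ × ℝ)} (hK : Convex ℝ K) {A B P Q : ℝ × ℝ} (hA : A ∈ K) (hB : B ∈ K)
    (hP : P ∈ K) (hQ : Q ∈ K) (h1 : cr (B - A) (P - A) ≤ 0) (h2 : 0 < cr (B - A) (Q - A)) :
    ENNReal.ofReal (|cr (B - A) (Q - P)| / 2) ≤ volume K := by
  have hH : MeasurableSet {X : ℝ × ℝ | 0 < cr (B - A) (X - A)} := by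
    apply IsOpen.measurableSet
    apply isOpen_lt continuous_const
    unfold cr
    fun_prop
  rw [← measure_inter_add_sdiff K hH]
  have e : |cr (B - A) (Q - P)| / 2 = |cr (B - A) (Q - A)| / 2 + |cr (B - A) (P - A)| / 2 := by
    have : cr (B - A) (Q - P) = cr (B - A) (Q - A) - cr (B - A) (P - A) := by
      simp [cr]; ring
    rw [this, abs_of_pos h2, abs_of_nonpos h1, abs_of_pos (by linarith)]
    ring
  rw [e, ENNReal.ofReal_add (by positivity) (by positivity), ← vol_tri, ← vol_tri]
  apply add_le_add
  · apply measure_mono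
    intro X hX
    refine ⟨tri_subset hK hA hB hQ hX, ?_⟩
    obtain ⟨t, ht, he⟩ := cr_tri hX
    show 0 < cr (B - A) (X - A)
    rw [he]
    positivity
  · apply measure_mono
    intro X hX
    refine ⟨tri_subset hK hA hB hP hX, ?_⟩
    obtain ⟨t, ht, he⟩ := cr_tri hX
    show ¬ (0 < cr (B - A) (X - A))
    rw [he, not_lt]
    exact mul_nonpos_of_nonneg_of_nonpos ht.le h1

theorem area_one {K : Set (ℝ × ℝ)} (hK : Convex ℝ K) {A B P : ℝ × ℝ} (hA : A ∈ K) (hB : B ∈ K)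
    (hP : P ∈ K) : ENNReal.ofReal (|cr (B - A) (P - A)| / 2) ≤ volume K := by
  rw [← vol_tri]
  exact measure_mono (tri_subset hK hA hB hP)

theorem area_cross {K : Set (ℝ × ℝ)} (hK : Convex ℝ K) {A B P Q : ℝ × ℝ} (hA : A ∈ K) (hB : B ∈ K)
    (hP : P ∈ K) (hQ : Q ∈ K) :
    ENNReal.ofReal (|cr (B - A) (Q - P)| / 2) ≤ volume K := by
  have this : cr (B - A) (Q - P) = cr (B - A) (Q - A) - cr (B - A) (P - A) := by
    simp [cr]; ring
  have this2 : cr (B - A) (P - Q) = - cr (B - A) (Q - P) := by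
    simp [cr]; ring
  rcases le_or_gt (cr (B - A) (P - A)) 0 with h1 | h1 <;>
    rcases le_or_gt (cr (B - A) (Q - A)) 0 with h2 | h2
  · rcases le_total (cr (B - A) (P - A)) (cr (B - A) (Q - A)) with h3 | h3
    · refine le_trans (ENNReal.ofReal_le_ofReal ?_) (area_one hK hA hB hP)
      rw [this, abs_of_nonneg (by linarith), abs_of_nonpos h1]
      linarith
    · refine le_trans (ENNReal.ofReal_le_ofReal ?_) (area_one hK hA hB hQ)
      rw [this, abs_of_nonpos (by linarith), abs_of_nonpos h2]
      linarith
  · exact area_opp hK hA hB hP hQ h1 h2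
  · have := area_opp hK hA hB hQ hP h2 h1
    rwa [this2, abs_neg] at this
  · rcases le_total (cr (B - A) (P - A)) (cr (B - A) (Q - A)) with h3 | h3
    · refine le_trans (ENNReal.ofReal_le_ofReal ?_) (area_one hK hA hB hQ)
      rw [this, abs_of_nonneg (by linarith), abs_of_pos h2]
      linarith
    · refine le_trans (ENNReal.ofReal_le_ofReal ?_) (area_one hK hA hB hP)
      rw [this, abs_of_nonpos (by linarith), abs_of_pos h1]
      linarith

theorem areaOf_ge (S : Finset (ℤ × ℤ)) {A B P Q : ℤ × ℤ} (hA : A ∈ S) (hB : B ∈ S)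
    (hP : P ∈ S) (hQ : Q ∈ S) :
    |(((B.1 - A.1) * (Q.2 - P.2) - (B.2 - A.2) * (Q.1 - P.1) : ℤ) : ℝ)| / 2 ≤ areaOf S := by
  have hm : ∀ X ∈ S, toR X ∈ convexHull ℝ (toR '' (S : Set (ℤ × ℤ))) := fun X hX =>
    subset_convexHull ℝ _ ⟨X, hX, rfl⟩
  have hfin : volume (convexHull ℝ (toR '' (S : Set (ℤ × ℤ)))) ≠ ⊤ := by
    have hc : IsCompact (convexHull ℝ (toR '' (S : Set (ℤ × ℤ)))) :=
      (S.finite_toSet.image toR).isCompact_convexHull (𝕜 := ℝ)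
    exact hc.measure_lt_top.ne
  have := area_cross (convex_convexHull ℝ _) (hm A hA) (hm B hB) (hm P hP) (hm Q hQ)
  have h2 := (ENNReal.ofReal_le_iff_le_toReal hfin).1 this
  unfold areaOf
  convert h2 using 3
  simp [cr, toR]

theorem zdot_add (u v p : ℤ × ℤ) : zdot (u + v) p = zdot u p + zdot v p := by
  simp [zdot]; ring

theorem zdot_sub (u v p : ℤ × ℤ) : zdot (u - v) p = zdot u p - zdot v p := by
  simp [zdot]; ring

theorem width_pts (u : ℤ × ℤ) (S : Finset (ℤ × ℤ)) (h : S.Nonempty) :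
    ∃ A ∈ S, ∃ B ∈ S, zdot u B - zdot u A = widthZ u S h := by
  obtain ⟨B, hB, hB'⟩ := S.exists_mem_eq_sup' h (zdot u)
  obtain ⟨A, hA, hA'⟩ := S.exists_mem_eq_inf' h (zdot u)
  exact ⟨A, hA, B, hB, by rw [widthZ, hB', hA']⟩

theorem width_le (u : ℤ × ℤ) (S : Finset (ℤ × ℤ)) (h : S.Nonempty) {A B : ℤ × ℤ}
    (hA : A ∈ S) (hB : B ∈ S) : zdot u B - zdot u A ≤ widthZ u S h := by
  have h1 := S.le_sup' (zdot u) hB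
  have h2 := S.inf'_le (zdot u) hA
  unfold widthZ
  linarith

theorem area_ge_coord (S : Finset (ℤ × ℤ)) {u v : ℤ × ℤ}
    (hdet : u.1 * v.2 - u.2 * v.1 = 1) {A B P Q : ℤ × ℤ} (hA : A ∈ S) (hB : B ∈ S)
    (hP : P ∈ S) (hQ : Q ∈ S) :
    |(((zdot u B - zdot u A) * (zdot v Q - zdot v P)
      - (zdot v B - zdot v A) * (zdot u Q - zdot u P) : ℤ) : ℝ)| / 2 ≤ areaOf S := by
  convert areaOf_ge S hA hB hP hQ using 4
  simp only [zdot]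
  linear_combination ((B.1 - A.1) * (Q.2 - P.2) - (B.2 - A.2) * (Q.1 - P.1)) * hdet

/-- Sign-normalised core. -/
theorem core (w w2 b c p q a : ℝ) (hw : 0 < w) (hw2 : w ≤ w2)
    (hb : 0 < b) (hc : 0 < c) (hp : 0 ≤ p) (hq : 0 ≤ q) (hpq : w ≤ p + q)
    (h1 : w * w2 - b * c ≤ 2 * a) (h2 : w * q + b * p ≤ 2 * a)
    (h3 : c * q + w2 * p ≤ 2 * a) : 3 / 8 * w ^ 2 ≤ a := by
  by_contra hh
  push Not at hh
  exact real_ineq w w2 b c p q hw hw2 hb hc hp hq hpq (by linarith) (by linarith) (by linarith)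

theorem main_basis (S : Finset (ℤ × ℤ)) (h : S.Nonempty) (w : ℤ) (hw : 0 < w) (u v : ℤ × ℤ)
    (hdet : u.1 * v.2 - u.2 * v.1 = 1) (hu : widthZ u S h = w) (hv : w ≤ widthZ v S h)
    (hadd : widthZ v S h ≤ widthZ (v + u) S h) (hsub : widthZ v S h ≤ widthZ (v - u) S h) :
    (3 / 8 : ℝ) * (w : ℝ) ^ 2 ≤ areaOf S := by
  obtain ⟨A, hA, B, hB, hAB⟩ := width_pts u S h
  obtain ⟨D, hD, C, hC, hDC⟩ := width_pts v S h
  have hwR : (0:ℝ) < w := by exact_mod_cast hw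
  have hvR : (w:ℝ) ≤ widthZ v S h := by exact_mod_cast hv
  have c1 := area_ge_coord S hdet hA hB hD hC
  rw [hAB, hDC, hu] at c1
  set b := zdot v B - zdot v A with hb
  set c := zdot u C - zdot u D with hc
  have d1 := le_trans (div_le_div_of_nonneg_right (le_abs_self _) (by norm_num)) c1
  push_cast at d1
  by_cases hbc : (b:ℝ) * c ≤ 0
  · nlinarith
  push Not at hbc
  rcases pos_and_pos_or_neg_and_neg_of_mul_pos hbc with ⟨hb0, hc0⟩ | ⟨hb0, hc0⟩
  · obtain ⟨P, hP, Q, hQ, hPQ⟩ := width_pts (v - u) S h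
    have c2 := area_ge_coord S hdet hA hB hP hQ
    have c3 := area_ge_coord S hdet hD hC hP hQ
    have w1 := width_le u S h hQ hP
    have w2 := width_le v S h hP hQ
    rw [zdot_sub, zdot_sub] at hPQ
    rw [hAB, hu, ← hb] at c2
    rw [hDC, ← hc] at c3
    have d2 := le_trans (div_le_div_of_nonneg_right (le_abs_self _) (by norm_num)) c2
    have d3 := le_trans (div_le_div_of_nonneg_right (le_abs_self _) (by norm_num)) c3
    push_cast at d2 d3
    have p0 : 0 ≤ zdot u P - zdot u Q := by linarith
    have q0 : 0 ≤ zdot v Q - zdot v P := by linarith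
    have pq0 : w ≤ (zdot u P - zdot u Q) + (zdot v Q - zdot v P) := by linarith
    refine core w (widthZ v S h) b c ((zdot u P - zdot u Q : ℤ) : ℝ)
      ((zdot v Q - zdot v P : ℤ) : ℝ) _ hwR hvR hb0 hc0 (by exact_mod_cast p0)
      (by exact_mod_cast q0) (by exact_mod_cast pq0) (by linarith) ?_ ?_
    · push_cast
      linarith
    · push_cast
      linarith
  · obtain ⟨P, hP, Q, hQ, hPQ⟩ := width_pts (v + u) S h
    have c2 := area_ge_coord S hdet hA hB hP hQ
    have c3 := area_ge_coord S hdet hD hC hP hQ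
    have w1 := width_le u S h hP hQ
    have w2 := width_le v S h hP hQ
    rw [zdot_add, zdot_add] at hPQ
    rw [hAB, hu, ← hb] at c2
    rw [hDC, ← hc] at c3
    have d2 := le_trans (div_le_div_of_nonneg_right (le_abs_self _) (by norm_num)) c2
    have d3 := le_trans (div_le_div_of_nonneg_right (neg_le_abs _) (by norm_num)) c3
    push_cast at d2 d3
    have p0 : 0 ≤ zdot u Q - zdot u P := by linarith
    have q0 : 0 ≤ zdot v Q - zdot v P := by linarith
    have pq0 : w ≤ (zdot u Q - zdot u P) + (zdot v Q - zdot v P) := by linarith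
    refine core w (widthZ v S h) (-b) (-c) ((zdot u Q - zdot u P : ℤ) : ℝ)
      ((zdot v Q - zdot v P : ℤ) : ℝ) _ hwR hvR (by linarith) (by linarith) (by exact_mod_cast p0)
      (by exact_mod_cast q0) (by exact_mod_cast pq0) (by linarith) ?_ ?_
    · push_cast
      linarith
    · push_cast
      linarith

theorem width_nonneg (u : ℤ × ℤ) (S : Finset (ℤ × ℤ)) (h : S.Nonempty) : 0 ≤ widthZ u S h := by
  obtain ⟨A, hA⟩ := id h
  have := width_le u S h hA hA
  linarith

theorem primitive_of_min (S : Finset (ℤ × ℤ)) (h : S.Nonempty) (w : ℤ) (hw : 0 < w) (u : ℤ × ℤ)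
    (hmin : ∀ u : ℤ × ℤ, u ≠ 0 → w ≤ widthZ u S h) (hu0 : u ≠ 0) (hu : widthZ u S h = w) :
    ∃ v : ℤ × ℤ, u.1 * v.2 - u.2 * v.1 = 1 := by
  set g : ℤ := (Int.gcd u.1 u.2 : ℤ) with hg
  obtain ⟨x, hx⟩ : g ∣ u.1 := Int.gcd_dvd_left _ _
  obtain ⟨y, hy⟩ : g ∣ u.2 := Int.gcd_dvd_right _ _
  have hg0 : 0 ≤ g := by positivity
  have hgne : g ≠ 0 := by
    intro h0
    apply hu0
    ext
    · simp [hx, h0]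
    · simp [hy, h0]
  have hxy : ((x, y) : ℤ × ℤ) ≠ 0 := by
    intro h0
    have h1 : x = 0 := congrArg Prod.fst h0
    have h2 : y = 0 := congrArg Prod.snd h0
    apply hu0
    ext
    · simp [hx, h1]
    · simp [hy, h2]
  have hz : ∀ p, zdot u p = g * zdot (x, y) p := by
    intro p
    simp only [zdot, hx, hy]
    ring
  have h1 := hmin _ hxy
  obtain ⟨A, hA, B, hB, hAB⟩ := width_pts (x, y) S h
  have h2 := width_le u S h hA hB
  rw [hu, hz, hz] at h2
  have hg1 : g = 1 := by
    by_contra hne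
    have : 2 ≤ g := by omega
    nlinarith
  have hbez := Int.gcd_eq_gcd_ab u.1 u.2
  rw [← hg, hg1] at hbez
  exact ⟨(-Int.gcdB u.1 u.2, Int.gcdA u.1 u.2), by simp only; linarith⟩

theorem area_ge_three_eighths_width_sq (S : Finset (ℤ × ℤ)) (h : S.Nonempty) (w : ℕ)
    (hmin : ∀ u : ℤ × ℤ, u ≠ 0 → (w : ℤ) ≤ widthZ u S h)
    (hatt : ∃ u : ℤ × ℤ, u ≠ 0 ∧ widthZ u S h = (w : ℤ)) :
    (3 / 8 : ℝ) * (w : ℝ) ^ 2 ≤ areaOf S := by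
  obtain ⟨u, hu0, hu⟩ := hatt
  rcases Nat.eq_zero_or_pos w with rfl | hw
  · simp [areaOf]
  have hwZ : (0:ℤ) < w := by exact_mod_cast hw
  have hne := primitive_of_min S h w hwZ u hmin hu0 hu
  let T : Set (ℤ × ℤ) := {v | u.1 * v.2 - u.2 * v.1 = 1}
  have hT : T.Nonempty := hne
  let f : ℤ × ℤ → ℕ := fun v => (widthZ v S h).toNat
  obtain ⟨v, hv, hvmin⟩ : ∃ v ∈ T, ∀ v' ∈ T, f v ≤ f v' := by
    refine ⟨Function.argminOn f T hT, Function.argminOn_mem f T hT, fun v' hv' => ?_⟩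
    exact Function.argminOn_le f T hv'
  have hle : ∀ v' ∈ T, widthZ v S h ≤ widthZ v' S h := by
    intro v' hv'
    have h1 := hvmin v' hv'
    have h2 := width_nonneg v S h
    have h3 := width_nonneg v' S h
    simp only [f] at h1
    omega
  have hv1 : u.1 * v.2 - u.2 * v.1 = 1 := hv
  have hv0 : v ≠ 0 := by
    rintro rfl
    simp at hv1
  have := main_basis S h w hwZ u v hv1 hu (hmin v hv0)
    (hle _ (by simp only [T, Set.mem_ofPred_eq, Prod.fst_add, Prod.snd_add]; linarith))
    (hle _ (by simp only [T, Set.mem_ofPred_eq, Prod.fst_sub, Prod.snd_sub]; linarith))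
  exact_mod_cast this
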